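/- arXiv:2409.03974 — 2 statements merged into one kernel-verified Lean document; each statement's English description precedes it below -/
import Mathlib

section
/- For every β ∈ ℝ, lim_{n→∞} (1/n) E_g[ log Z^bis(β, g) − log Z(β, g) ] = 0, where the expectation is over the SK disorder g. -/
open MeasureTheory ProbabilityTheory Filter

noncomputable section

/-- The value of a ±1 spin encoded as a Boolean. -/
def spin (b : Bool) : ℝ := if b then 1 else -1

/-- The Ising Hamiltonian `H(σ; X) = ∑_{i,j} X i j σ(i) σ(j)`. -/
def Ham {n : ℕ} (X : Fin n → Fin n → ℝ) (σ : Fin n → Bool) : ℝ :=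
  ∑ i, ∑ j, X i j * spin (σ i) * spin (σ j)

/-- The partition function `Z(β, X)`. -/
def Zpart {n : ℕ} (β : ℝ) (X : Fin n → Fin n → ℝ) : ℝ :=
  ∑ σ : Fin n → Bool, Real.exp (-β * Ham X σ)

/-- The Gibbs probability mass function `μ_{β,X}(σ)`. -/
def gibbs {n : ℕ} (β : ℝ) (X : Fin n → Fin n → ℝ) (σ : Fin n → Bool) : ℝ :=
  Real.exp (-β * Ham X σ) / Zpart β X

/-- A configuration is a bisection if `|∑ i σ(i)| ≤ 1`. -/
def isBis {n : ℕ} (σ : Fin n → Bool) : Prop := |∑ i, spin (σ i)| ≤ 1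

open scoped Classical in
/-- The bisection partition function `Z^bis(β, X)`. -/
def ZpartBis {n : ℕ} (β : ℝ) (X : Fin n → Fin n → ℝ) : ℝ :=
  ∑ σ : Fin n → Bool, if isBis σ then Real.exp (-β * Ham X σ) else 0

open scoped Classical in
/-- The bisection Gibbs probability mass function `μ^bis_{β,X}(σ)`. -/
def gibbsBis {n : ℕ} (β : ℝ) (X : Fin n → Fin n → ℝ) (σ : Fin n → Bool) : ℝ :=
  if isBis σ then Real.exp (-β * Ham X σ) / ZpartBis β X else 0

/-- The overlap `R_{1,2}(σ1, σ2) = (1/n) ∑ i σ1(i) σ2(i)`. -/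
def overlap {n : ℕ} (σ1 σ2 : Fin n → Bool) : ℝ :=
  (1 / (n : ℝ)) * ∑ i, spin (σ1 i) * spin (σ2 i)

/-- Gibbs average of a one-variable observable. -/
def avg1 {n : ℕ} (β : ℝ) (X : Fin n → Fin n → ℝ) (f : (Fin n → Bool) → ℝ) : ℝ :=
  ∑ σ : Fin n → Bool, f σ * gibbs β X σ

/-- Bisection Gibbs average of a one-variable observable. -/
def avg1Bis {n : ℕ} (β : ℝ) (X : Fin n → Fin n → ℝ) (f : (Fin n → Bool) → ℝ) : ℝ :=
  ∑ σ : Fin n → Bool, f σ * gibbsBis β X σ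

/-- Coupled Gibbs average: `σ1 ~ μ_{β,X}`, `σ2 ~ μ_{β,Y}` independent. -/
def avg2c {n : ℕ} (β : ℝ) (X Y : Fin n → Fin n → ℝ)
    (f : (Fin n → Bool) → (Fin n → Bool) → ℝ) : ℝ :=
  ∑ σ1 : Fin n → Bool, ∑ σ2 : Fin n → Bool, f σ1 σ2 * gibbs β X σ1 * gibbs β Y σ2

/-- Gibbs average of a two-replica observable. -/
def avg2 {n : ℕ} (β : ℝ) (X : Fin n → Fin n → ℝ)
    (f : (Fin n → Bool) → (Fin n → Bool) → ℝ) : ℝ :=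
  avg2c β X X f

/-- Coupled bisection Gibbs average. -/
def avg2cBis {n : ℕ} (β : ℝ) (X Y : Fin n → Fin n → ℝ)
    (f : (Fin n → Bool) → (Fin n → Bool) → ℝ) : ℝ :=
  ∑ σ1 : Fin n → Bool, ∑ σ2 : Fin n → Bool, f σ1 σ2 * gibbsBis β X σ1 * gibbsBis β Y σ2

/-- Bisection Gibbs average of a two-replica observable. -/
def avg2Bis {n : ℕ} (β : ℝ) (X : Fin n → Fin n → ℝ)
    (f : (Fin n → Bool) → (Fin n → Bool) → ℝ) : ℝ :=
  avg2cBis β X X f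

/-- The SK disorder: i.i.d. entries `N(0, 1/(2n))`. -/
def skMeasure (n : ℕ) : Measure (Fin n → Fin n → ℝ) :=
  Measure.pi fun _ => Measure.pi fun _ => gaussianReal 0 (1 / (2 * n))

/-- The law of the pair `(g, g')` of independent SK disorders. -/
def skPair (n : ℕ) : Measure ((Fin n → Fin n → ℝ) × (Fin n → Fin n → ℝ)) :=
  (skMeasure n).prod (skMeasure n)

/-- The perturbed SK disorder `g_t = √(1-t) g + √t g'`. -/
def skPerturb {n : ℕ} (t : ℝ) (g g' : Fin n → Fin n → ℝ) : Fin n → Fin n → ℝ :=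
  fun i j => Real.sqrt (1 - t) * g i j + Real.sqrt t * g' i j

/-- The sparse disorder: i.i.d. entries `Poisson(d/(2n))`. -/
def sparseMeasure (n : ℕ) (d : ℝ) : Measure (Fin n → Fin n → ℕ) :=
  Measure.pi fun _ => Measure.pi fun _ => poissonMeasure (d / (2 * n)).toNNReal

/-- The law of the triple `(A^{(1-t)}, A^{(t,1)}, A^{(t,2)})` of independent sparse disorders
used to build the coupled pair `A = A^{(1-t)} + A^{(t,1)}`, `A_t = A^{(1-t)} + A^{(t,2)}`. -/
def coupledSparse (n : ℕ) (d t : ℝ) :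
    Measure ((Fin n → Fin n → ℕ) × (Fin n → Fin n → ℕ) × (Fin n → Fin n → ℕ)) :=
  (sparseMeasure n ((1 - t) * d)).prod
    ((sparseMeasure n (t * d)).prod (sparseMeasure n (t * d)))

/-- View an ℕ-valued matrix as a real matrix. -/
def natMat {n : ℕ} (A : Fin n → Fin n → ℕ) : Fin n → Fin n → ℝ := fun i j => (A i j : ℝ)

/-- The Gibbs measure `μ_{β,X}` as a probability measure on configurations. -/
def gibbsMeasure {n : ℕ} (β : ℝ) (X : Fin n → Fin n → ℝ) : Measure (Fin n → Bool) :=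
  ∑ σ : Fin n → Bool, ENNReal.ofReal (gibbs β X σ) • Measure.dirac σ

/-- The bisection Gibbs measure `μ^bis_{β,X}` as a measure on configurations. -/
def gibbsBisMeasure {n : ℕ} (β : ℝ) (X : Fin n → Fin n → ℝ) : Measure (Fin n → Bool) :=
  ∑ σ : Fin n → Bool, ENNReal.ofReal (gibbsBis β X σ) • Measure.dirac σ

/-- Normalized Wasserstein distance `W_{2,n}` between measures on `{-1,1}^n`. -/
def W2 (n : ℕ) (μ1 μ2 : Measure (Fin n → Bool)) : ℝ :=
  sInf {r : ℝ | ∃ π : Measure ((Fin n → Bool) × (Fin n → Bool)),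
    IsProbabilityMeasure π ∧ π.map Prod.fst = μ1 ∧ π.map Prod.snd = μ2 ∧
    r = Real.sqrt (∫ p, (1 / (n : ℝ)) * ∑ i, (spin (p.1 i) - spin (p.2 i)) ^ 2 ∂π)}

open scoped Classical in
/-- Overlap-restricted coupled partition function `Z^S_{X,Y}`. -/
def Zres {n : ℕ} (β : ℝ) (S : Set ℝ) (X Y : Fin n → Fin n → ℝ) : ℝ :=
  ∑ σ1 : Fin n → Bool, ∑ σ2 : Fin n → Bool,
    if overlap σ1 σ2 ∈ S then Real.exp (-β * (Ham X σ1 + Ham Y σ2)) else 0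

open scoped Classical in
/-- Overlap-restricted coupled bisection partition function `Z^{S,bis}_{X,Y}`. -/
def ZresBis {n : ℕ} (β : ℝ) (S : Set ℝ) (X Y : Fin n → Fin n → ℝ) : ℝ :=
  ∑ σ1 : Fin n → Bool, ∑ σ2 : Fin n → Bool,
    if isBis σ1 ∧ isBis σ2 ∧ overlap σ1 σ2 ∈ S
    then Real.exp (-β * (Ham X σ1 + Ham Y σ2)) else 0

/-- The matrix with a single `1` in position `(i,j)`. -/
def Jmat {n : ℕ} (i j : Fin n) : Fin n → Fin n → ℝ :=
  fun a b => if a = i ∧ b = j then 1 else 0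

end

/-- The measure `μ` has Gaussian exponential moments with variance proxy `2 * c` for every
measurable function which is `1`-Lipschitz with respect to the cost `d`. -/
def LipschitzExpMoment {Ω : Type*} [MeasurableSpace Ω] (μ : Measure Ω) (d : Ω → Ω → ℝ)
    (c : ℝ) : Prop :=
  ∀ F : Ω → ℝ, Measurable F → (∀ x y, |F x - F y| ≤ d x y) → ∀ s : ℝ,
    Integrable (fun x => Real.exp (s * F x)) μ ∧
      ∫ x, Real.exp (s * F x) ∂μ ≤ Real.exp (s * ∫ x, F x ∂μ + c * s ^ 2)

section Concentration

variable {Ω Ω' : Type*} [MeasurableSpace Ω] [MeasurableSpace Ω']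

/-- A function with finite exponential moments at `±1` is integrable. -/
lemma integrable_of_integrable_exp {μ : Measure Ω} {F : Ω → ℝ} (hF : Measurable F)
    (h : ∀ s : ℝ, Integrable (fun x => Real.exp (s * F x)) μ) : Integrable F μ := by
  refine ((h 1).add (h (-1))).mono' hF.aestronglyMeasurable (Eventually.of_forall fun x => ?_)
  simp only [Real.norm_eq_abs, Pi.add_apply, one_mul, neg_one_mul]
  have h1 := Real.add_one_le_exp (F x)
  have h2 := Real.add_one_le_exp (-F x)
  have h3 := Real.exp_pos (F x)
  have h4 := Real.exp_pos (-F x)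
  rw [abs_le]
  constructor <;> linarith

lemma LipschitzExpMoment.integrable {μ : Measure Ω} {d : Ω → Ω → ℝ} {c : ℝ}
    (hμ : LipschitzExpMoment μ d c) {F : Ω → ℝ} (hF : Measurable F)
    (hd : ∀ x y, |F x - F y| ≤ d x y) : Integrable F μ :=
  integrable_of_integrable_exp hF fun s => (hμ F hF hd s).1

/-- Gaussian exponential moments tensorize. -/
lemma LipschitzExpMoment.prod {μ : Measure Ω} {ν : Measure Ω'} [IsProbabilityMeasure μ]
    [IsProbabilityMeasure ν] {d : Ω → Ω → ℝ} {e : Ω' → Ω' → ℝ} {c c' : ℝ}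
    (hμ : LipschitzExpMoment μ d c) (hν : LipschitzExpMoment ν e c')
    (hd0 : ∀ x, d x x = 0) (he0 : ∀ y, e y y = 0) :
    LipschitzExpMoment (μ.prod ν) (fun p q => d p.1 q.1 + e p.2 q.2) (c + c') := by
  intro F hF hL
  have hslice (y : Ω') : Measurable fun x => F (x, y) := hF.comp measurable_prodMk_right
  have hsliceL (y : Ω') (x x' : Ω) : |F (x, y) - F (x', y)| ≤ d x x' := by
    simpa [he0] using hL (x, y) (x', y)
  have hint (y : Ω') : Integrable (fun x => F (x, y)) μ := hμ.integrable (hslice y) (hsliceL y)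
  set G : Ω' → ℝ := fun y => ∫ x, F (x, y) ∂μ with hG
  have hGm : Measurable G := hF.stronglyMeasurable.integral_prod_left'.measurable
  have hGL (y y' : Ω') : |G y - G y'| ≤ e y y' := by
    rw [hG]
    simp only
    rw [← integral_sub (hint y) (hint y'), ← Real.norm_eq_abs]
    refine (norm_integral_le_of_norm_le_const (C := e y y')
      (Eventually.of_forall fun x => ?_)).trans ?_
    · simpa [hd0] using hL (x, y) (x, y')
    · simp
  have hbound (s : ℝ) (y : Ω') :
      ∫ x, Real.exp (s * F (x, y)) ∂μ ≤ Real.exp (c * s ^ 2) * Real.exp (s * G y) := by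
    rw [← Real.exp_add, add_comm]
    exact (hμ _ (hslice y) (hsliceL y) s).2
  have hexpm (s : ℝ) : Measurable fun p : Ω × Ω' => Real.exp (s * F p) := by fun_prop
  have hGint (s : ℝ) : Integrable (fun y => ∫ x, Real.exp (s * F (x, y)) ∂μ) ν := by
    refine ((hν G hGm hGL s).1.const_mul (Real.exp (c * s ^ 2))).mono'
      (hexpm s).stronglyMeasurable.integral_prod_left'.aestronglyMeasurable
      (Eventually.of_forall fun y => ?_)
    rw [Real.norm_of_nonneg (integral_nonneg fun x => (Real.exp_pos _).le)]
    exact hbound s y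
  have hexp (s : ℝ) : Integrable (fun p : Ω × Ω' => Real.exp (s * F p)) (μ.prod ν) := by
    rw [integrable_prod_iff' (hexpm s).aestronglyMeasurable]
    refine ⟨Eventually.of_forall fun y => (hμ _ (hslice y) (hsliceL y) s).1, ?_⟩
    simpa using hGint s
  intro s
  refine ⟨hexp s, ?_⟩
  rw [integral_prod_symm _ (hexp s), integral_prod_symm _ (integrable_of_integrable_exp hF hexp)]
  calc ∫ y, ∫ x, Real.exp (s * F (x, y)) ∂μ ∂ν
      ≤ ∫ y, Real.exp (c * s ^ 2) * Real.exp (s * G y) ∂ν :=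
        integral_mono (hGint s) ((hν G hGm hGL s).1.const_mul _) (hbound s)
    _ = Real.exp (c * s ^ 2) * ∫ y, Real.exp (s * G y) ∂ν := integral_const_mul _ _
    _ ≤ Real.exp (c * s ^ 2) * Real.exp (s * ∫ y, G y ∂ν + c' * s ^ 2) := by
        gcongr
        exact (hν G hGm hGL s).2
    _ = Real.exp (s * ∫ y, G y ∂ν + (c + c') * s ^ 2) := by
        rw [← Real.exp_add]
        ring_nf

lemma LipschitzExpMoment.pi {μ : Measure Ω} [IsProbabilityMeasure μ] {d : Ω → Ω → ℝ} {c : ℝ}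
    (hμ : LipschitzExpMoment μ d c) (hd0 : ∀ x, d x x = 0) (n : ℕ) :
    LipschitzExpMoment (Measure.pi fun _ : Fin n => μ) (fun x y => ∑ i, d (x i) (y i))
      (n * c) := by
  induction n with
  | zero =>
    intro F hF hL s
    have hc : F = fun _ => F default := funext fun x => congrArg F (Subsingleton.elim _ _)
    rw [hc]
    simp
  | succ n ih =>
    have hprod := hμ.prod ih hd0 (fun y => by simp [hd0])
    intro F hF hL s
    let E := MeasurableEquiv.piFinSuccAbove (fun _ : Fin (n + 1) => Ω) 0
    have hE : MeasurePreserving E (Measure.pi fun _ : Fin (n + 1) => μ)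
        (μ.prod (Measure.pi fun _ : Fin n => μ)) :=
      measurePreserving_piFinSuccAbove (fun _ : Fin (n + 1) => μ) 0
    have h := hprod (F ∘ E.symm) (hF.comp E.symm.measurable) (fun p q => by
      have := hL (E.symm p) (E.symm q)
      simpa [E, MeasurableEquiv.piFinSuccAbove, Fin.sum_univ_succ] using this) s
    have hcomp := hE.integrable_comp_emb E.measurableEmbedding
      (g := fun p => Real.exp (s * (F ∘ E.symm) p))
    have hI1 := hE.integral_comp E.measurableEmbedding (fun p => Real.exp (s * (F ∘ E.symm) p))
    have hI2 := hE.integral_comp E.measurableEmbedding (F ∘ E.symm)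
    simp only [Function.comp_def, MeasurableEquiv.symm_apply_apply] at h hcomp hI1 hI2
    refine ⟨hcomp.2 h.1, ?_⟩
    rw [hI1, hI2]
    refine h.2.trans_eq ?_
    push_cast
    ring_nf

end Concentration

lemma lipschitzExpMoment_gaussianReal (v : NNReal) {L : ℝ} (hL0 : 0 ≤ L) :
    LipschitzExpMoment (gaussianReal 0 v) (fun x y => L * |x - y|) (L ^ 2 * v) := by
  intro F hF hL
  have hcosh {a b : ℝ} (h : |a| ≤ |b|) :
      Real.exp a + Real.exp (-a) ≤ Real.exp b + Real.exp (-b) := by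
    have := Real.cosh_le_cosh.2 h
    rw [Real.cosh_eq, Real.cosh_eq] at this
    linarith
  have hmgf (t : ℝ) : ∫ x, Real.exp (t * x) ∂(gaussianReal 0 v) = Real.exp (v * t ^ 2 / 2) := by
    simpa [mgf] using congrFun (mgf_id_gaussianReal (μ := 0) (v := v)) t
  have hexp (s : ℝ) : Integrable (fun x => Real.exp (s * F x)) (gaussianReal 0 v) := by
    refine (((integrable_exp_mul_gaussianReal (μ := 0) (v := v) (s * L)).add
      (integrable_exp_mul_gaussianReal (-(s * L)))).const_mul (Real.exp (s * F 0))).mono'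
      (by fun_prop) (Eventually.of_forall fun x => ?_)
    rw [Real.norm_of_nonneg (Real.exp_pos _).le]
    have h1 : |s * (F x - F 0)| ≤ |s * L * x| := by
      rw [abs_mul, mul_assoc, abs_mul s, abs_mul L, abs_of_nonneg hL0]
      gcongr
      simpa using hL x 0
    have h2 := hcosh h1
    have h3 : Real.exp (s * F x) = Real.exp (s * F 0) * Real.exp (s * (F x - F 0)) := by
      rw [← Real.exp_add]; ring_nf
    rw [h3]
    simp only [Pi.add_apply, neg_mul]
    gcongr
    linarith [Real.exp_pos (-(s * (F x - F 0)))]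
  have hFint := integrable_of_integrable_exp hF hexp
  intro s
  refine ⟨hexp s, ?_⟩
  set μ := gaussianReal 0 v
  have hjensen : Real.exp (-(s * ∫ x, F x ∂μ)) ≤ ∫ x, Real.exp (-s * F x) ∂μ := by
    have := convexOn_exp.map_integral_le (μ := μ) (f := fun x => -s * F x)
      Real.continuous_exp.continuousOn isClosed_univ (by simp) (hFint.const_mul _) (hexp (-s))
    rwa [integral_const_mul, neg_mul] at this
  have hsymm : 2 * ((∫ x, Real.exp (s * F x) ∂μ) * ∫ x, Real.exp (-s * F x) ∂μ) ≤
      2 * ((∫ x, Real.exp (s * L * x) ∂μ) * ∫ x, Real.exp (-(s * L) * x) ∂μ) := by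
    have key (f : ℝ → ℝ) (s : ℝ) (hf : ∀ s : ℝ, Integrable (fun x => Real.exp (s * f x)) μ) :
        Integrable (fun p : ℝ × ℝ => Real.exp (s * f p.1) * Real.exp (-s * f p.2) +
          Real.exp (-s * f p.1) * Real.exp (s * f p.2)) (μ.prod μ) ∧
        ∫ p : ℝ × ℝ, (Real.exp (s * f p.1) * Real.exp (-s * f p.2) +
          Real.exp (-s * f p.1) * Real.exp (s * f p.2)) ∂(μ.prod μ) =
        2 * ((∫ x, Real.exp (s * f x) ∂μ) * ∫ x, Real.exp (-s * f x) ∂μ) := by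
      have h1 := (hf s).mul_prod (hf (-s))
      have h2 := (hf (-s)).mul_prod (hf s)
      refine ⟨h1.add h2, ?_⟩
      rw [integral_add h1 h2, integral_prod_mul (fun x => Real.exp (s * f x))
        (fun x => Real.exp (-s * f x)), integral_prod_mul (fun x => Real.exp (-s * f x))
        (fun x => Real.exp (s * f x))]
      ring
    obtain ⟨h1, h2⟩ := key F s hexp
    obtain ⟨h3, h4⟩ := key (fun x => x) (s * L) (fun t => integrable_exp_mul_gaussianReal t)
    rw [← h2, ← h4]
    refine integral_mono h1 h3 fun p => ?_
    simp only [← Real.exp_add]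
    have h5 : |s * (F p.1 - F p.2)| ≤ |s * L * (p.1 - p.2)| := by
      rw [abs_mul, mul_assoc, abs_mul s, abs_mul L, abs_of_nonneg hL0]
      gcongr
      exact hL _ _
    refine le_of_eq_of_le ?_ ((hcosh h5).trans_eq ?_) <;> ring_nf
  rw [hmgf, hmgf, ← Real.exp_add] at hsymm
  have hA : 0 ≤ ∫ x, Real.exp (s * F x) ∂μ := integral_nonneg fun x => (Real.exp_pos _).le
  have h6 : (∫ x, Real.exp (s * F x) ∂μ) * Real.exp (-(s * ∫ x, F x ∂μ)) ≤
      Real.exp (v * (s * L) ^ 2 / 2 + v * (-(s * L)) ^ 2 / 2) :=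
    (mul_le_mul_of_nonneg_left hjensen hA).trans (by linarith)
  rw [Real.exp_neg, ← div_eq_mul_inv, div_le_iff₀ (Real.exp_pos _), ← Real.exp_add] at h6
  refine h6.trans_eq ?_
  ring_nf

section Gauge

variable {n : ℕ}

/-- The sign vector which is `-1` on the first `k` sites and `1` elsewhere. -/
def prefixSign (n k : ℕ) (i : Fin n) : ℝ := if (i : ℕ) < k then -1 else 1

/-- Flip the first `k` spins of a configuration. -/
def flipPrefix (k : ℕ) (σ : Fin n → Bool) (i : Fin n) : Bool :=
  if (i : ℕ) < k then !σ i else σ i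

/-- The gauge transformation of the disorder by the sign vector `prefixSign n k`. -/
def gaugeTransform (k : ℕ) (X : Fin n → Fin n → ℝ) : Fin n → Fin n → ℝ :=
  fun i j => prefixSign n k i * prefixSign n k j * X i j

lemma abs_spin (b : Bool) : |spin b| = 1 := by cases b <;> simp [spin]

lemma spin_flipPrefix (k : ℕ) (σ : Fin n → Bool) (i : Fin n) :
    spin (flipPrefix k σ i) = prefixSign n k i * spin (σ i) := by
  unfold flipPrefix prefixSign spin
  split_ifs <;> simp_all

lemma flipPrefix_involutive (k : ℕ) : Function.Involutive (flipPrefix (n := n) k) := by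
  intro σ
  funext i
  unfold flipPrefix
  split_ifs <;> simp

lemma Ham_gaugeTransform (k : ℕ) (X : Fin n → Fin n → ℝ) (σ : Fin n → Bool) :
    Ham (gaugeTransform k X) σ = Ham X (flipPrefix k σ) := by
  simp only [Ham, gaugeTransform, spin_flipPrefix]
  exact Finset.sum_congr rfl fun i _ => Finset.sum_congr rfl fun j _ => by ring

/-- Flipping a suitable prefix turns any configuration into a bisection. -/
lemma exists_isBis_flipPrefix (σ : Fin n → Bool) :
    ∃ k ∈ Finset.range (n + 1), isBis (flipPrefix k σ) := by
  by_contra! h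
  simp only [isBis, Finset.mem_range, spin_flipPrefix, not_le] at h
  set f : ℕ → ℝ := fun k => ∑ i, prefixSign n k i * spin (σ i) with hf
  have h0 : f n = -f 0 := by simp [hf, prefixSign]
  have hstep (k : ℕ) (hk : k < n) : |f (k + 1) - f k| ≤ 2 := by
    have : f (k + 1) - f k = -2 * spin (σ ⟨k, hk⟩) := by
      simp only [hf, ← Finset.sum_sub_distrib]
      rw [Finset.sum_eq_single ⟨k, hk⟩]
      · simp [prefixSign]
        ring
      · intro i _ hi
        have hi' : (i : ℕ) ≠ k := fun e => hi (Fin.ext e)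
        have : (i : ℕ) < k + 1 ↔ (i : ℕ) < k := by omega
        simp [prefixSign, this]
      · simp
    rw [this, abs_mul, abs_spin]
    norm_num
  have hgap (k : ℕ) (hk : k ≤ n) : 1 < |f k| := h k (by omega)
  rcases lt_abs.1 (hgap 0 (Nat.zero_le n)) with hpos | hneg
  · have hall (k : ℕ) (hk : k ≤ n) : 1 < f k := by
      induction k with
      | zero => exact hpos
      | succ k ih =>
        have h1 := ih (by omega)
        have h2 := abs_le.1 (hstep k hk)
        rcases lt_abs.1 (hgap (k + 1) hk) with h3 | h3 <;> linarith
    linarith [hall n le_rfl]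
  · have hall (k : ℕ) (hk : k ≤ n) : f k < -1 := by
      induction k with
      | zero => linarith
      | succ k ih =>
        have h1 := ih (by omega)
        have h2 := abs_le.1 (hstep k hk)
        rcases lt_abs.1 (hgap (k + 1) hk) with h3 | h3 <;> linarith
    linarith [hall n le_rfl]

lemma measurePreserving_gaugeTransform (k : ℕ) :
    MeasurePreserving (gaugeTransform (n := n) k) (skMeasure n) (skMeasure n) := by
  have hentry (a : ℝ) (ha : a ^ 2 = 1) : MeasurePreserving (fun x : ℝ => a * x)
      (gaussianReal 0 (1 / (2 * n))) (gaussianReal 0 (1 / (2 * n))) := by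
    refine ⟨by fun_prop, ?_⟩
    rw [gaussianReal_map_const_mul]
    congr 1
    · simp
    · ext
      simp [ha]
  refine measurePreserving_pi _ _ fun i => measurePreserving_pi _ _ fun j => hentry _ ?_
  unfold prefixSign
  split_ifs <;> norm_num

end Gauge

section Restricted

variable {n : ℕ}

/-- The partition function restricted to the configurations in `A`. -/
noncomputable def restrictedZ (β : ℝ) (A : Finset (Fin n → Bool)) (X : Fin n → Fin n → ℝ) : ℝ :=
  ∑ σ ∈ A, Real.exp (-β * Ham X σ)

open scoped Classical in
/-- The finite set of bisections. -/
noncomputable def bisections (n : ℕ) : Finset (Fin n → Bool) := Finset.univ.filter isBis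

lemma ZpartBis_eq (β : ℝ) (X : Fin n → Fin n → ℝ) :
    ZpartBis β X = restrictedZ β (bisections n) X := by
  simp [ZpartBis, restrictedZ, bisections, Finset.sum_filter]

lemma restrictedZ_pos (β : ℝ) {A : Finset (Fin n → Bool)} (hA : A.Nonempty)
    (X : Fin n → Fin n → ℝ) : 0 < restrictedZ β A X :=
  Finset.sum_pos (fun _ _ => Real.exp_pos _) hA

lemma bisections_nonempty (n : ℕ) : (bisections n).Nonempty := by
  obtain ⟨k, -, hk⟩ := exists_isBis_flipPrefix (n := n) fun _ => true
  exact ⟨_, by simpa [bisections] using hk⟩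

lemma measurable_log_restrictedZ (β : ℝ) (A : Finset (Fin n → Bool)) :
    Measurable fun X => Real.log (restrictedZ β A X) := by
  unfold restrictedZ Ham
  fun_prop

lemma abs_Ham_sub_le (X Y : Fin n → Fin n → ℝ) (σ : Fin n → Bool) :
    |Ham X σ - Ham Y σ| ≤ ∑ i, ∑ j, |X i j - Y i j| := by
  unfold Ham
  simp only [← Finset.sum_sub_distrib]
  refine (Finset.abs_sum_le_sum_abs _ _).trans (Finset.sum_le_sum fun i _ => ?_)
  refine (Finset.abs_sum_le_sum_abs _ _).trans (Finset.sum_le_sum fun j _ => ?_)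
  rw [← sub_mul, ← sub_mul, abs_mul, abs_mul, abs_spin, abs_spin, mul_one, mul_one]

lemma abs_log_restrictedZ_sub_le (β : ℝ) {A : Finset (Fin n → Bool)} (hA : A.Nonempty)
    (X Y : Fin n → Fin n → ℝ) :
    |Real.log (restrictedZ β A X) - Real.log (restrictedZ β A Y)| ≤
      ∑ i, ∑ j, |β| * |X i j - Y i j| := by
  have hone (X Y : Fin n → Fin n → ℝ) :
      Real.log (restrictedZ β A X) - Real.log (restrictedZ β A Y) ≤
        ∑ i, ∑ j, |β| * |X i j - Y i j| := by
    rw [sub_le_iff_le_add, Real.log_le_iff_le_exp (restrictedZ_pos β hA X), Real.exp_add,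
      Real.exp_log (restrictedZ_pos β hA Y)]
    unfold restrictedZ
    rw [Finset.mul_sum]
    refine Finset.sum_le_sum fun σ _ => ?_
    rw [← Real.exp_add]
    refine Real.exp_le_exp.2 ?_
    have h1 : -β * (Ham X σ - Ham Y σ) ≤ |β| * ∑ i, ∑ j, |X i j - Y i j| :=
      (le_abs_self _).trans (by
        rw [abs_mul, abs_neg]
        exact mul_le_mul_of_nonneg_left (abs_Ham_sub_le X Y σ) (abs_nonneg β))
    simp only [Finset.mul_sum] at h1
    linarith
  refine abs_sub_le_iff.2 ⟨hone X Y, (hone Y X).trans_eq ?_⟩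
  simp only [abs_sub_comm]

/-- The prefix gauge transformations of the bisections cover the whole cube. -/
lemma Zpart_le_sum_gaugeTransform (β : ℝ) (X : Fin n → Fin n → ℝ) :
    Zpart β X ≤ ∑ k ∈ Finset.range (n + 1), restrictedZ β (bisections n) (gaugeTransform k X) := by
  classical
  have hreindex (k : ℕ) : restrictedZ β (bisections n) (gaugeTransform k X) =
      ∑ σ, if isBis (flipPrefix k σ) then Real.exp (-β * Ham X σ) else 0 := by
    rw [← Equiv.sum_comp (flipPrefix_involutive k).toPerm]
    simp [restrictedZ, bisections, Finset.sum_filter, Ham_gaugeTransform,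
      flipPrefix_involutive k _]
  simp only [hreindex]
  rw [Finset.sum_comm, Zpart]
  refine Finset.sum_le_sum fun σ _ => ?_
  obtain ⟨k, hk, hσ⟩ := exists_isBis_flipPrefix σ
  refine le_of_eq_of_le (if_pos hσ).symm (Finset.single_le_sum
    (f := fun k => if isBis (flipPrefix k σ) then Real.exp (-β * Ham X σ) else 0) ?_ hk)
  intro i _
  positivity

end Restricted

lemma lipschitzExpMoment_skMeasure (β : ℝ) (n : ℕ) :
    LipschitzExpMoment (skMeasure n) (fun X Y => ∑ i, ∑ j, |β| * |X i j - Y i j|)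
      (β ^ 2 * n / 2) := by
  have h := ((lipschitzExpMoment_gaussianReal (1 / (2 * n)) (abs_nonneg β)).pi
    (fun x => by simp) n).pi (fun x => by simp) n
  have hc : (n : ℝ) * (n * (|β| ^ 2 * ((1 / (2 * n) : NNReal) : ℝ))) = β ^ 2 * n / 2 := by
    rcases eq_or_ne n 0 with rfl | hn
    · simp
    · have : (n : ℝ) ≠ 0 := by exact_mod_cast hn
      push_cast
      rw [sq_abs]
      field_simp
  rwa [hc] at h

instance (n : ℕ) : IsProbabilityMeasure (skMeasure n) := by
  unfold skMeasure
  infer_instance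

lemma rpow_sum_le_sum_rpow {ι : Type*} (A : Finset ι) (f : ι → ℝ) (hf : ∀ i ∈ A, 0 ≤ f i)
    {p : ℝ} (hp : 0 < p) (hp1 : p ≤ 1) : (∑ i ∈ A, f i) ^ p ≤ ∑ i ∈ A, f i ^ p :=
  Finset.le_sum_of_subadditive_on_pred (fun x : ℝ => x ^ p) (fun x => 0 ≤ x)
    (by simp [Real.zero_rpow hp.ne'])
    (fun _ _ hx hy => Real.rpow_add_le_add_rpow hx hy hp.le hp1)
    (fun _ _ hx hy => add_nonneg hx hy) f hf

section FreeEnergy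

variable {n : ℕ}

lemma integrable_log_restrictedZ (β : ℝ) {A : Finset (Fin n → Bool)} (hA : A.Nonempty) :
    Integrable (fun g => Real.log (restrictedZ β A g)) (skMeasure n) :=
  (lipschitzExpMoment_skMeasure β n).integrable (measurable_log_restrictedZ β A)
    (abs_log_restrictedZ_sub_le β hA)

lemma Zpart_eq (β : ℝ) (X : Fin n → Fin n → ℝ) : Zpart β X = restrictedZ β Finset.univ X := rfl

lemma restrictedZ_mono (β : ℝ) {A B : Finset (Fin n → Bool)} (hAB : A ⊆ B)
    (X : Fin n → Fin n → ℝ) : restrictedZ β A X ≤ restrictedZ β B X :=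
  Finset.sum_le_sum_of_subset_of_nonneg hAB fun _ _ _ => (Real.exp_pos _).le

lemma integral_log_Zpart_le (β : ℝ) {s : ℝ} (hs : 0 < s) (hs1 : s ≤ 1) :
    s * ∫ g, Real.log (Zpart β g) ∂(skMeasure n) ≤
      Real.log (n + 1) + s * ∫ g, Real.log (ZpartBis β g) ∂(skMeasure n) +
        β ^ 2 * n / 2 * s ^ 2 := by
  simp only [ZpartBis_eq]
  set F : (Fin n → Fin n → ℝ) → ℝ := fun g => Real.log (restrictedZ β (bisections n) g)
  set m := ∫ g, F g ∂(skMeasure n)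
  obtain ⟨hint, hle⟩ := lipschitzExpMoment_skMeasure β n F
    (measurable_log_restrictedZ β _) (abs_log_restrictedZ_sub_le β (bisections_nonempty n)) s
  set b := s * m + β ^ 2 * n / 2 * s ^ 2 with hb
  have hZint : Integrable (fun g => Real.log (Zpart β g)) (skMeasure n) :=
    integrable_log_restrictedZ β Finset.univ_nonempty
  have hgint (k : ℕ) :
      Integrable (fun g => Real.exp (s * F (gaugeTransform k g))) (skMeasure n) :=
    (measurePreserving_gaugeTransform k).integrable_comp_of_integrable hint
  have hgval (k : ℕ) : ∫ g, Real.exp (s * F (gaugeTransform k g)) ∂(skMeasure n) =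
      ∫ g, Real.exp (s * F g) ∂(skMeasure n) := by
    have h := integral_map (measurePreserving_gaugeTransform (n := n) k).aemeasurable
      (f := fun g => Real.exp (s * F g))
      (by rw [(measurePreserving_gaugeTransform k).map_eq]; exact hint.aestronglyMeasurable)
    rw [(measurePreserving_gaugeTransform k).map_eq] at h
    exact h.symm
  have hn : (0 : ℝ) < n + 1 := by positivity
  have hpoint (g : Fin n → Fin n → ℝ) : s * Real.log (Zpart β g) ≤
      (∑ k ∈ Finset.range (n + 1), Real.exp (s * F (gaugeTransform k g))) *
        ((n + 1) * Real.exp b)⁻¹ + (Real.log (n + 1) + b - 1) := by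
    have hpos (k : ℕ) : 0 < restrictedZ β (bisections n) (gaugeTransform k g) :=
      restrictedZ_pos β (bisections_nonempty n) _
    have hZ : 0 < Zpart β g := restrictedZ_pos β Finset.univ_nonempty g
    have h1 : Zpart β g ^ s ≤
        ∑ k ∈ Finset.range (n + 1), Real.exp (s * F (gaugeTransform k g)) := by
      refine (Real.rpow_le_rpow hZ.le (Zpart_le_sum_gaugeTransform β g) hs.le).trans
        ((rpow_sum_le_sum_rpow _ _ (fun k _ => (hpos k).le) hs hs1).trans_eq ?_)
      refine Finset.sum_congr rfl fun k _ => ?_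
      rw [Real.rpow_def_of_pos (hpos k), mul_comm]
    have hZs : 0 < Zpart β g ^ s := Real.rpow_pos_of_pos hZ s
    have h2 := Real.log_le_sub_one_of_pos
      (x := Zpart β g ^ s * ((n + 1) * Real.exp b)⁻¹) (by positivity)
    rw [Real.log_mul hZs.ne' (by positivity), Real.log_inv, Real.log_rpow hZ,
      Real.log_mul hn.ne' (Real.exp_pos b).ne', Real.log_exp] at h2
    have h3 := mul_le_mul_of_nonneg_right h1
      (by positivity : (0 : ℝ) ≤ ((n + 1) * Real.exp b)⁻¹)
    linarith
  have hsumint : Integrable (fun g => ∑ k ∈ Finset.range (n + 1),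
      Real.exp (s * F (gaugeTransform k g))) (skMeasure n) :=
    integrable_finsetSum _ fun k _ => hgint k
  have hI := integral_mono (hZint.const_mul s)
    ((hsumint.mul_const _).add (integrable_const _)) hpoint
  simp only [Pi.add_apply] at hI
  rw [integral_const_mul, integral_add (hsumint.mul_const _) (integrable_const _),
    integral_mul_const, integral_finsetSum _ fun k _ => hgint k] at hI
  simp only [hgval, Finset.sum_const, Finset.card_range, nsmul_eq_mul, integral_const,
    probReal_univ, smul_eq_mul, one_mul] at hI
  push_cast at hI
  have h4 : ((n : ℝ) + 1) * (∫ g, Real.exp (s * F g) ∂(skMeasure n)) *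
      ((n + 1) * Real.exp b)⁻¹ ≤ 1 := by
    rw [← div_eq_mul_inv, div_le_one (by positivity)]
    exact mul_le_mul_of_nonneg_left hle hn.le
  linarith

lemma integral_log_sub_nonpos (β : ℝ) (n : ℕ) :
    ∫ g, (Real.log (ZpartBis β g) - Real.log (Zpart β g)) ∂(skMeasure n) ≤ 0 := by
  refine integral_nonpos fun g => sub_nonpos.2 ?_
  rw [ZpartBis_eq, Zpart_eq]
  exact Real.log_le_log (restrictedZ_pos β (bisections_nonempty n) g)
    (restrictedZ_mono β (Finset.subset_univ _) g)

lemma le_inv_mul_integral_log_sub (β : ℝ) (hn : 0 < n) :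
    -((Real.log (n + 1) + β ^ 2 / 2) / √n) ≤
      1 / (n : ℝ) * ∫ g, (Real.log (ZpartBis β g) - Real.log (Zpart β g)) ∂(skMeasure n) := by
  have hn1 : (1 : ℝ) ≤ n := by exact_mod_cast hn
  have hr : 1 ≤ √(n : ℝ) := Real.one_le_sqrt.2 hn1
  have hr0 : 0 < √(n : ℝ) := by linarith
  have hsq : √(n : ℝ) ^ 2 = n := Real.sq_sqrt (by positivity)
  have h := integral_log_Zpart_le (n := n) β (inv_pos.2 hr0) (inv_le_one_of_one_le₀ hr)
  have hbis : Integrable (fun g => Real.log (ZpartBis β g)) (skMeasure n) := by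
    simpa only [ZpartBis_eq] using integrable_log_restrictedZ β (bisections_nonempty n)
  have hfull : Integrable (fun g => Real.log (Zpart β g)) (skMeasure n) :=
    integrable_log_restrictedZ β Finset.univ_nonempty
  rw [integral_sub hbis hfull]
  set a := ∫ g, Real.log (ZpartBis β g) ∂(skMeasure n)
  set z := ∫ g, Real.log (Zpart β g) ∂(skMeasure n)
  generalize √(n : ℝ) = r at *
  rw [← hsq] at h ⊢
  have h1 : β ^ 2 * r ^ 2 / 2 * r⁻¹ ^ 2 = β ^ 2 / 2 := by field_simp
  rw [h1] at h
  have h2 : 0 ≤ r⁻¹ * (Real.log (r ^ 2 + 1) + r⁻¹ * a + β ^ 2 / 2 - r⁻¹ * z) :=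
    mul_nonneg (by positivity) (by linarith)
  have h3 : r⁻¹ * (Real.log (r ^ 2 + 1) + r⁻¹ * a + β ^ 2 / 2 - r⁻¹ * z) =
      (Real.log (r ^ 2 + 1) + β ^ 2 / 2) / r + 1 / r ^ 2 * (a - z) := by
    field_simp
    ring
  linarith

end FreeEnergy

lemma tendsto_log_add_const_div_sqrt (c : ℝ) :
    Tendsto (fun n : ℕ => (Real.log ((n : ℝ) + 1) + c) / √n) atTop (nhds 0) := by
  have hlog : Tendsto (fun x : ℝ => Real.log x / x ^ (1 / 2 : ℝ)) atTop (nhds 0) :=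
    (isLittleO_log_rpow_atTop (by norm_num)).tendsto_div_nhds_zero
  have hupper : Tendsto (fun n : ℕ => (Real.log (n : ℝ) / (n : ℝ) ^ (1 / 2 : ℝ)) +
      (Real.log 2 + c) / √n) atTop (nhds 0) := by
    have h1 := hlog.comp tendsto_natCast_atTop_atTop
    have h2 : Tendsto (fun n : ℕ => (Real.log 2 + c) / √(n : ℝ)) atTop (nhds 0) :=
      (Real.tendsto_sqrt_atTop.comp tendsto_natCast_atTop_atTop).const_div_atTop _
    simpa using h1.add h2
  have hlower : Tendsto (fun n : ℕ => c / √(n : ℝ)) atTop (nhds 0) :=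
    (Real.tendsto_sqrt_atTop.comp tendsto_natCast_atTop_atTop).const_div_atTop _
  refine tendsto_of_tendsto_of_tendsto_of_le_of_le' hlower hupper ?_ ?_
  · filter_upwards with n
    gcongr
    linarith [Real.log_nonneg (by linarith [n.cast_nonneg (α := ℝ)] : (1 : ℝ) ≤ (n : ℝ) + 1)]
  · filter_upwards [eventually_ge_atTop 1] with n hn
    have hn1 : (1 : ℝ) ≤ n := by exact_mod_cast hn
    rw [← Real.sqrt_eq_rpow, ← add_div]
    refine div_le_div_of_nonneg_right ?_ (Real.sqrt_nonneg _)
    rw [← add_assoc, ← Real.log_mul (by positivity) (by norm_num)]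
    gcongr
    linarith

/-- the bisection restriction does not change the SK free
energy. -/
theorem stmt_16 (β : ℝ) :
    Tendsto (fun n : ℕ =>
      (1 / (n : ℝ)) * ∫ g, (Real.log (ZpartBis β g) - Real.log (Zpart β g)) ∂(skMeasure n))
      atTop (nhds 0) := by
  have hlower := (tendsto_log_add_const_div_sqrt (β ^ 2 / 2)).neg
  rw [neg_zero] at hlower
  refine tendsto_of_tendsto_of_tendsto_of_le_of_le' hlower tendsto_const_nhds ?_ ?_
  · filter_upwards [eventually_gt_atTop 0] with n hn
    exact le_inv_mul_integral_log_sub β hn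
  · filter_upwards with n
    exact mul_nonpos_of_nonneg_of_nonpos (by positivity) (integral_log_sub_nonpos β n)
end

section
/- For every ε > 0 there exists δ > 0 such that for all sufficiently large d > 0 the following holds: for every n ∈ ℕ, every σ ∈ {-1,1}^n and every τ ∈ A_n such that τ is a nearest bisection for σ (i.e. R_{1,2}(τ,σ) = max_{τ' ∈ A_n} R_{1,2}(τ',σ)), one has P[ H(τ; A) − H(σ; A) ≥ ε · √d · n ] ≤ 2 · exp(−δ · d^{1/4} · n), where the probability is over the sparse disorder A. -/
open MeasureTheory ProbabilityTheory Filter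

lemma spin_sq (b : Bool) : spin b ^ 2 = 1 := by
  cases b <;> norm_num [spin]

lemma spin_not (b : Bool) : spin (!b) = -spin b := by
  cases b <;> norm_num [spin]

/-- The magnetization in terms of the number of spins equal to `b`. -/
lemma sum_spin_eq {n : ℕ} (σ : Fin n → Bool) (b : Bool) :
    ∑ i, spin (σ i) = spin b * (2 * ((Finset.univ.filter fun i => σ i = b).card : ℝ) - n) := by
  have h : ∀ i, spin (σ i) = spin b * (2 * (if σ i = b then (1 : ℝ) else 0) - 1) := by
    intro i
    cases b <;> cases σ i <;> norm_num [spin]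
  simp only [h, ← Finset.mul_sum, Finset.sum_sub_distrib, Finset.sum_boole]
  simp

/-- The squared magnetization of a bisection is the parity of `n`. -/
lemma isBis.sq_sum_eq {n : ℕ} {τ : Fin n → Bool} (hτ : isBis τ) :
    (∑ i, spin (τ i)) ^ 2 = ((n % 2 : ℕ) : ℝ) := by
  unfold isBis at hτ
  rw [sum_spin_eq τ true] at hτ ⊢
  generalize (Finset.univ.filter fun i => τ i = true).card = q at hτ ⊢
  simp only [spin, if_true, one_mul] at hτ ⊢
  have hz : |2 * (q : ℤ) - n| ≤ 1 := by exact_mod_cast hτ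
  have key : (2 * (q : ℤ) - n) ^ 2 = ((n % 2 : ℕ) : ℤ) := by
    obtain ⟨h1, h2⟩ := abs_le.1 hz
    have : 2 * (q : ℤ) - n = -1 ∨ 2 * (q : ℤ) - n = 0 ∨ 2 * (q : ℤ) - n = 1 := by omega
    rcases this with h | h | h <;> rw [h] <;> norm_num <;> omega
  have hcast := congrArg (Int.cast : ℤ → ℝ) key
  rw [Int.cast_natCast] at hcast
  rw [← hcast]
  push_cast
  rfl

/-- Flipping some majority spins yields a bisection at the expected distance. -/
lemma exists_isBis_sub_sum_le {n : ℕ} (σ : Fin n → Bool) :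
    ∃ τ : Fin n → Bool, isBis τ ∧
      (n : ℝ) - ∑ i, spin (τ i) * spin (σ i) ≤ |∑ i, spin (σ i)| - |∑ i, spin (τ i)| := by
  obtain ⟨b, hb⟩ : ∃ b, n ≤ 2 * (Finset.univ.filter fun i => σ i = b).card := by
    by_contra! h
    have h1 := h true
    have h2 := h false
    have h3 := Finset.card_filter_add_card_filter_not (s := (Finset.univ : Finset (Fin n)))
      (fun i => σ i = true)
    simp only [Bool.not_eq_true, Finset.card_univ, Fintype.card_fin] at h3
    omega
  set P := Finset.univ.filter fun i => σ i = b with hP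
  obtain ⟨S, hSP, hS⟩ := Finset.exists_subset_card_eq
    (show P.card - (n + 1) / 2 ≤ P.card by omega)
  have hk : ((n + 1) / 2) + S.card = P.card := by omega
  have hpar : 2 * ((n + 1) / 2) = n + n % 2 := by omega
  have hpar' : 2 * (((n + 1) / 2 : ℕ) : ℝ) = n + (n % 2 : ℕ) := by exact_mod_cast hpar
  have hk' : (((n + 1) / 2 : ℕ) : ℝ) + S.card = P.card := by exact_mod_cast hk
  have hsb : |spin b| = 1 := by cases b <;> norm_num [spin]
  have hσ : ∑ i, spin (σ i) = spin b * ((n % 2 : ℕ) + 2 * S.card) := by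
    rw [sum_spin_eq σ b, ← hP]
    congr 1
    linarith
  have hflip : ∀ i, spin (if i ∈ S then !σ i else σ i)
      = spin (σ i) - 2 * spin b * (if i ∈ S then 1 else 0) := by
    intro i
    by_cases hi : i ∈ S
    · have : σ i = b := by simpa [hP] using hSP hi
      simp only [hi, if_true, this, spin_not]
      ring
    · simp [hi]
  have hτ : ∑ i, spin (if i ∈ S then !σ i else σ i) = spin b * (n % 2 : ℕ) := by
    simp only [hflip, Finset.sum_sub_distrib, ← Finset.mul_sum, hσ, Finset.sum_boole]
    simp only [Finset.filter_univ_mem]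
    ring
  have hm : ((n % 2 : ℕ) : ℝ) ≤ 1 := by exact_mod_cast (by omega : n % 2 ≤ 1)
  refine ⟨fun i => if i ∈ S then !σ i else σ i, ?_, ?_⟩
  · rw [isBis, hτ, abs_mul, hsb, one_mul, abs_of_nonneg (by positivity)]
    exact hm
  · have hov : ∀ i, spin (if i ∈ S then !σ i else σ i) * spin (σ i)
        = 1 - 2 * (if i ∈ S then 1 else 0) := by
      intro i
      by_cases hi : i ∈ S
      · simp only [hi, if_true, spin_not]
        linear_combination -spin_sq (σ i)
      · simp only [hi, if_false]
        linear_combination spin_sq (σ i)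
    rw [hτ, hσ, abs_mul, abs_mul, hsb, abs_of_nonneg (by positivity), abs_of_nonneg (by positivity)]
    simp only [hov, Finset.sum_sub_distrib, ← Finset.mul_sum, Finset.sum_boole]
    simp

/-- The unnormalized distance to a nearest bisection is controlled by the loss of squared
magnetization. -/
lemma sq_sub_sum_le_of_nearest {n : ℕ} {σ τ : Fin n → Bool} (hτ : isBis τ)
    (hnear : ∀ τ' : Fin n → Bool, isBis τ' → overlap τ' σ ≤ overlap τ σ) :
    ((n : ℝ) - ∑ i, spin (τ i) * spin (σ i)) ^ 2
      ≤ (∑ i, spin (σ i)) ^ 2 - (∑ i, spin (τ i)) ^ 2 := by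
  rcases Nat.eq_zero_or_pos n with rfl | hn
  · simp
  obtain ⟨ρ, hρ, hle⟩ := exists_isBis_sub_sum_le σ
  have hn' : (0 : ℝ) < 1 / n := by positivity
  have h1 := le_of_mul_le_mul_left (hnear ρ hρ) hn'
  have h0 : ∑ i, spin (τ i) * spin (σ i) ≤ n := by
    calc ∑ i, spin (τ i) * spin (σ i) ≤ ∑ _i : Fin n, (1 : ℝ) := by
          refine Finset.sum_le_sum fun i _ => ?_
          cases τ i <;> cases σ i <;> norm_num [spin]
      _ = n := by simp
  rw [hτ.sq_sum_eq, ← hρ.sq_sum_eq, ← sq_abs (∑ i, spin (σ i)), ← sq_abs (∑ i, spin (ρ i))]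
  have h2 := abs_nonneg (∑ i, spin (ρ i))
  nlinarith

lemma hasSum_poisson_exp_mul (r : NNReal) (t : ℝ) :
    HasSum (fun k : ℕ => Real.exp (-r) * (r : ℝ) ^ k / (k.factorial : ℝ) * Real.exp (t * k))
      (Real.exp (r * (Real.exp t - 1))) := by
  have h := (NormedSpace.expSeries_div_hasSum_exp ((r : ℝ) * Real.exp t)).mul_left (Real.exp (-r))
  rw [← Real.exp_eq_exp_ℝ, ← Real.exp_add] at h
  convert! h using 1
  · ext k
    rw [mul_pow, ← Real.exp_nat_mul, mul_comm t]
    ring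
  · congr 1
    ring

lemma integrable_exp_mul_poissonMeasure (r : NNReal) (t : ℝ) :
    Integrable (fun k : ℕ => Real.exp (t * k)) (poissonMeasure r) := by
  rw [integrable_poissonMeasure_iff]
  simpa only [Real.norm_eq_abs, Real.abs_exp] using (hasSum_poisson_exp_mul r t).summable

lemma integral_exp_mul_poissonMeasure (r : NNReal) (t : ℝ) :
    ∫ k : ℕ, Real.exp (t * k) ∂poissonMeasure r = Real.exp (r * (Real.exp t - 1)) := by
  rw [integral_poissonMeasure]
  simpa only [smul_eq_mul] using (hasSum_poisson_exp_mul r t).tsum_eq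

instance isProbabilityMeasure_sparseMeasure (n : ℕ) (d : ℝ) :
    IsProbabilityMeasure (sparseMeasure n d) := by
  unfold sparseMeasure
  infer_instance

lemma exp_mul_sum_eq_prod {n : ℕ} (c : Fin n → Fin n → ℝ) (t : ℝ) (A : Fin n → Fin n → ℕ) :
    Real.exp (t * ∑ i, ∑ j, c i j * A i j) = ∏ i, ∏ j, Real.exp (t * c i j * A i j) := by
  simp only [← Real.exp_sum, Finset.mul_sum, mul_assoc]

lemma integrable_exp_linear_sparseMeasure {n : ℕ} (d : ℝ) (c : Fin n → Fin n → ℝ) (t : ℝ) :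
    Integrable (fun A : Fin n → Fin n → ℕ => Real.exp (t * ∑ i, ∑ j, c i j * A i j))
      (sparseMeasure n d) := by
  simp only [exp_mul_sum_eq_prod]
  exact Integrable.fintype_prod
    (f := fun (i : Fin n) (a : Fin n → ℕ) => ∏ j, Real.exp (t * c i j * a j))
    fun i => Integrable.fintype_prod (f := fun (j : Fin n) (k : ℕ) => Real.exp (t * c i j * k))
      fun j => integrable_exp_mul_poissonMeasure _ _

/-- The moment generating function of a linear statistic of the sparse disorder. -/
lemma mgf_linear_sparseMeasure {n : ℕ} {d : ℝ} (hd : 0 ≤ d) (c : Fin n → Fin n → ℝ) (t : ℝ) :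
    mgf (fun A : Fin n → Fin n → ℕ => ∑ i, ∑ j, c i j * A i j) (sparseMeasure n d) t
      = Real.exp (d / (2 * n) * ∑ i, ∑ j, (Real.exp (t * c i j) - 1)) := by
  have hr : ((d / (2 * n)).toNNReal : ℝ) = d / (2 * n) := Real.coe_toNNReal _ (by positivity)
  simp only [mgf, exp_mul_sum_eq_prod, sparseMeasure]
  rw [integral_fintype_prod_eq_prod
    (f := fun (i : Fin n) (a : Fin n → ℕ) => ∏ j, Real.exp (t * c i j * a j))]
  simp only [Finset.mul_sum, Real.exp_sum]
  refine Finset.prod_congr rfl fun i _ => ?_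
  rw [integral_fintype_prod_eq_prod (f := fun (j : Fin n) (k : ℕ) => Real.exp (t * c i j * k))]
  simp only [integral_exp_mul_poissonMeasure, hr]

lemma sum_sum_mul_eq_sq {n : ℕ} (f : Fin n → ℝ) :
    ∑ i, ∑ j, f i * f j = (∑ i, f i) ^ 2 := by
  rw [sq, Finset.sum_mul_sum]

/-- A Chernoff bound for the energy increment to a nearest bisection. -/
lemma sparseMeasure_real_ham_sub_le {n : ℕ} {d t x : ℝ} (hd : 0 ≤ d) (ht : 0 ≤ t)
    (ht' : t ≤ 1 / 2) {σ τ : Fin n → Bool} (hτ : isBis τ)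
    (hnear : ∀ τ' : Fin n → Bool, isBis τ' → overlap τ' σ ≤ overlap τ σ) :
    (sparseMeasure n d).real {A | x ≤ Ham (natMat A) τ - Ham (natMat A) σ}
      ≤ Real.exp (2 * d * t ^ 3 * n - t * x) := by
  set c : Fin n → Fin n → ℝ := fun i j => spin (τ i) * spin (τ j) - spin (σ i) * spin (σ j) with hc
  have hHam : ∀ A : Fin n → Fin n → ℕ,
      Ham (natMat A) τ - Ham (natMat A) σ = ∑ i, ∑ j, c i j * A i j := by
    intro A
    simp only [Ham, natMat, ← Finset.sum_sub_distrib, hc]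
    refine Finset.sum_congr rfl fun i _ => Finset.sum_congr rfl fun j _ => ?_
    ring
  simp only [hHam]
  refine (measure_ge_le_exp_mul_mgf x ht (integrable_exp_linear_sparseMeasure d c t)).trans ?_
  rw [mgf_linear_sparseMeasure hd, ← Real.exp_add, Real.exp_le_exp]
  have hterm : ∀ i j, Real.exp (t * c i j) - 1 ≤ t * c i j + t ^ 2 * c i j ^ 2 := by
    intro i j
    have hcb : |c i j| ≤ 2 := by
      simp only [hc]
      cases τ i <;> cases τ j <;> cases σ i <;> cases σ j <;> norm_num [spin]
    have h1 : |t * c i j| ≤ 1 := by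
      rw [abs_mul, abs_of_nonneg ht]
      nlinarith [abs_nonneg (c i j)]
    have h2 := (abs_le.1 (Real.abs_exp_sub_one_sub_id_le h1)).2
    nlinarith
  set T := ∑ i, spin (τ i)
  set m := ∑ i, spin (σ i)
  set R := ∑ i, spin (τ i) * spin (σ i) with hR
  have hu : ((n : ℝ) - R) ^ 2 ≤ m ^ 2 - T ^ 2 := sq_sub_sum_le_of_nearest hτ hnear
  have hsum : ∑ i, ∑ j, c i j = T ^ 2 - m ^ 2 := by
    simp only [hc, Finset.sum_sub_distrib]
    rw [sum_sum_mul_eq_sq fun i => spin (τ i), sum_sum_mul_eq_sq fun i => spin (σ i)]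
  have hsq : ∑ i, ∑ j, c i j ^ 2 = 2 * (n : ℝ) ^ 2 - 2 * R ^ 2 := by
    have : ∀ i j, c i j ^ 2
        = 2 - 2 * ((spin (τ i) * spin (σ i)) * (spin (τ j) * spin (σ j))) := by
      intro i j
      simp only [hc]
      linear_combination spin (τ j) ^ 2 * spin_sq (τ i) + spin_sq (τ j)
        + spin (σ j) ^ 2 * spin_sq (σ i) + spin_sq (σ j)
    simp only [this, Finset.sum_sub_distrib, ← Finset.mul_sum]
    simp only [Finset.mul_sum, Finset.sum_const, Finset.card_univ, Fintype.card_fin, nsmul_eq_mul]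
    rw [← sum_sum_mul_eq_sq]
    simp only [Finset.mul_sum]
    ring
  have hbound : ∑ i, ∑ j, (Real.exp (t * c i j) - 1) ≤ 4 * t ^ 3 * (n : ℝ) ^ 2 := by
    calc ∑ i, ∑ j, (Real.exp (t * c i j) - 1)
        ≤ ∑ i, ∑ j, (t * c i j + t ^ 2 * c i j ^ 2) :=
          Finset.sum_le_sum fun i _ => Finset.sum_le_sum fun j _ => hterm i j
      _ = t * (T ^ 2 - m ^ 2) + t ^ 2 * (2 * (n : ℝ) ^ 2 - 2 * R ^ 2) := by
          simp only [Finset.sum_add_distrib, ← Finset.mul_sum, hsum, hsq]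
      _ ≤ 4 * t ^ 3 * (n : ℝ) ^ 2 := by
          have h1 := mul_le_mul_of_nonneg_left hu ht
          have h2 := mul_nonneg ht (sq_nonneg ((n : ℝ) - R - 2 * t * n))
          have h3 : 0 ≤ t ^ 2 * ((n : ℝ) - R) ^ 2 := by positivity
          nlinarith
  have hfin : d / (2 * n) * ∑ i, ∑ j, (Real.exp (t * c i j) - 1) ≤ 2 * d * t ^ 3 * n := by
    refine (mul_le_mul_of_nonneg_left hbound (by positivity)).trans (le_of_eq ?_)
    rcases Nat.eq_zero_or_pos n with rfl | hn
    · simp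
    · field_simp
      ring
  linarith

/-- the Hamiltonian of a nearest bisection exceeds that of the
original configuration by `ε√d n` only with exponentially small probability. -/
theorem stmt_17 (ε : ℝ) (hε : 0 < ε) :
    ∃ δ : ℝ, 0 < δ ∧ ∃ d0 : ℝ, 0 < d0 ∧ ∀ d : ℝ, d0 ≤ d →
      ∀ n : ℕ, ∀ σ τ : Fin n → Bool, isBis τ →
        (∀ τ' : Fin n → Bool, isBis τ' → overlap τ' σ ≤ overlap τ σ) →
        sparseMeasure n d
            {A | ε * Real.sqrt d * (n : ℝ) ≤ Ham (natMat A) τ - Ham (natMat A) σ}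
          ≤ ENNReal.ofReal (2 * Real.exp (-δ * d ^ ((1 : ℝ) / 4) * (n : ℝ))) := by
  set a := Real.sqrt ε with ha
  have ha0 : 0 < a := Real.sqrt_pos.2 hε
  have haε : a ^ 2 = ε := Real.sq_sqrt hε.le
  refine ⟨a * ε / 4, by positivity, max 1 (ε ^ 2), by positivity, ?_⟩
  intro d hd n σ τ hτ hnear
  have hd1 : 1 ≤ d := (le_max_left _ _).trans hd
  have hd0 : 0 < d := by linarith
  set q := d ^ ((1 : ℝ) / 4) with hq
  have hq0 : 0 < q := Real.rpow_pos_of_pos hd0 _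
  have hq4 : q ^ 4 = d := by
    rw [hq, ← Real.rpow_natCast, ← Real.rpow_mul hd0.le]
    norm_num
  have hsqrt : Real.sqrt d = q ^ 2 := by
    rw [← hq4, show q ^ 4 = (q ^ 2) ^ 2 by ring, Real.sqrt_sq (by positivity)]
  have haq : a ≤ q := by
    refine le_of_pow_le_pow_left₀ (n := 4) (by norm_num) hq0.le ?_
    rw [hq4, show a ^ 4 = (a ^ 2) ^ 2 by ring, haε]
    exact (le_max_right _ _).trans hd
  have ht' : a / (2 * q) ≤ 1 / 2 := by
    rw [div_le_div_iff₀ (by positivity) (by norm_num)]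
    linarith
  have key := sparseMeasure_real_ham_sub_le (x := ε * Real.sqrt d * n) hd0.le
    (by positivity : 0 ≤ a / (2 * q)) ht' hτ hnear
  have hexp : 2 * d * (a / (2 * q)) ^ 3 * n - a / (2 * q) * (ε * Real.sqrt d * n)
      = -(a * ε / 4) * q * n := by
    rw [hsqrt, ← hq4, ← haε]
    field_simp
    ring
  rw [hexp] at key
  rw [← ofReal_measureReal]
  refine ENNReal.ofReal_le_ofReal (key.trans ?_)
  linarith [Real.exp_pos (-(a * ε / 4) * q * n)]
end
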